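/- The number of well-labelled positive paths of size n equals (2n-1)!!. -/

import Mathlib

/-- The steps of the word are letters in `{-1,0,+1}`. -/
def StepsOK (n : ℕ) (p : Fin (n - 1) → ℤ) : Prop :=
  ∀ i, p i = -1 ∨ p i = 0 ∨ p i = 1

/-- Compatibility between the word and the permutation: a `-1` step forces an ascent
of the labels and a `+1` step forces a descent. -/
def Compat (n : ℕ) (p : Fin (n - 1) → ℤ) (σ : Equiv.Perm (Fin n)) : Prop :=
  ∀ i : Fin (n - 1),
    (p i = -1 → σ ⟨i.1, by have := i.isLt; omega⟩ < σ ⟨i.1 + 1, by have := i.isLt; omega⟩) ∧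
    (p i = 1 → σ ⟨i.1 + 1, by have := i.isLt; omega⟩ < σ ⟨i.1, by have := i.isLt; omega⟩)

/-- Partial sum `p 1 + ... + p j` of the word. -/
def psum (n : ℕ) (p : Fin (n - 1) → ℤ) (j : ℕ) : ℤ :=
  ∑ i ∈ Finset.univ.filter (fun i : Fin (n - 1) => i.1 < j), p i

/-- Well-labelled positive path of size `n`. -/
def IsPositivePath (n : ℕ) (p : Fin (n - 1) → ℤ) (σ : Equiv.Perm (Fin n)) : Prop :=
  StepsOK n p ∧ Compat n p σ ∧ ∀ j ≤ n - 1, 0 ≤ psum n p j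

/-- Well-labelled Motzkin path of size `n`. -/
def IsMotzkinPath (n : ℕ) (p : Fin (n - 1) → ℤ) (σ : Equiv.Perm (Fin n)) : Prop :=
  StepsOK n p ∧ Compat n p σ ∧ (∀ j ≤ n - 2, 0 ≤ psum n p j) ∧ psum n p (n - 1) = -1

/-- Number of well-labelled Motzkin paths of size `n`. -/
noncomputable def motzkinCount (n : ℕ) : ℕ :=
  Nat.card {ps : (Fin (n - 1) → ℤ) × Equiv.Perm (Fin n) // IsMotzkinPath n ps.1 ps.2}

/-- Number of well-labelled positive paths of size `n`. -/
noncomputable def positiveCount (n : ℕ) : ℕ :=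
  Nat.card {ps : (Fin (n - 1) → ℤ) × Equiv.Perm (Fin n) // IsPositivePath n ps.1 ps.2}

/-- Number of horizontal steps (letters `0`) of a word. -/
def horizCount (n : ℕ) (p : Fin (n - 1) → ℤ) : ℕ :=
  (Finset.univ.filter (fun i => p i = 0)).card

open Finset in
theorem sum_antidiagonal_centralBinom_mul (n : ℕ) :
    ∑ ij ∈ antidiagonal n, ij.1.centralBinom * ij.2.centralBinom = 4 ^ n := by
  have key : ∀ m, 2 * ∑ ij ∈ antidiagonal m, ij.1 * (ij.1.centralBinom * ij.2.centralBinom) =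
      m * ∑ ij ∈ antidiagonal m, ij.1.centralBinom * ij.2.centralBinom := by
    intro m
    have hswap : ∑ ij ∈ antidiagonal m, ij.1 * (ij.1.centralBinom * ij.2.centralBinom) =
        ∑ ij ∈ antidiagonal m, ij.2 * (ij.1.centralBinom * ij.2.centralBinom) := by
      rw [← Nat.sum_antidiagonal_swap]
      exact sum_congr rfl fun ij _ => by simp only [Prod.fst_swap, Prod.snd_swap]; ring
    rw [two_mul]
    nth_rewrite 2 [hswap]
    rw [← sum_add_distrib, mul_sum]
    refine sum_congr rfl fun ij hij => ?_
    rw [← mem_antidiagonal.1 hij]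
    ring
  induction n with
  | zero => simp
  | succ n ih =>
    have h := key (n + 1)
    have h' : ∑ ij ∈ antidiagonal (n + 1), ij.1 * (ij.1.centralBinom * ij.2.centralBinom) =
        2 * (2 * ∑ ij ∈ antidiagonal n, ij.1 * (ij.1.centralBinom * ij.2.centralBinom)) +
        2 * ∑ ij ∈ antidiagonal n, ij.1.centralBinom * ij.2.centralBinom := by
      rw [Nat.sum_antidiagonal_succ]
      simp only [zero_mul, zero_add, mul_sum, ← sum_add_distrib]
      refine sum_congr rfl fun ij _ => ?_
      rw [← mul_assoc, Nat.succ_mul_centralBinom_succ]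
      ring
    rw [h', key, ih] at h
    refine Nat.eq_of_mul_eq_mul_left n.succ_pos ?_
    rw [Nat.succ_eq_add_one, ← h]
    ring

theorem two_pow_mul_doubleFactorial (n : ℕ) :
    2 ^ n * (2 * n - 1).doubleFactorial = n.factorial * n.centralBinom := by
  induction n with
  | zero => simp
  | succ n ih =>
    have h : (2 * (n + 1) - 1).doubleFactorial = (2 * n + 1) * (2 * n - 1).doubleFactorial := by
      cases n with
      | zero => simp
      | succ m => exact Nat.doubleFactorial_add_two (2 * m + 1)
    have h' := Nat.succ_mul_centralBinom_succ n
    rw [h, Nat.factorial_succ]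
    calc 2 ^ (n + 1) * ((2 * n + 1) * (2 * n - 1).doubleFactorial)
        = 2 * (2 * n + 1) * (2 ^ n * (2 * n - 1).doubleFactorial) := by ring
      _ = n.factorial * (2 * (2 * n + 1) * n.centralBinom) := by rw [ih]; ring
      _ = _ := by rw [← h']; ring

open Finset in
theorem sum_choose_mul_doubleFactorial (n : ℕ) :
    ∑ k ∈ range (n + 1), n.choose k *
      ((2 * k - 1).doubleFactorial * (2 * (n - k) - 1).doubleFactorial) =
        2 ^ n * n.factorial := by
  refine Nat.eq_of_mul_eq_mul_left (pow_pos two_pos n) ?_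
  have h := sum_antidiagonal_centralBinom_mul n
  rw [Nat.sum_antidiagonal_eq_sum_range_succ_mk] at h
  rw [← mul_assoc, ← pow_add, ← two_mul, pow_mul, show 2 ^ 2 = 4 from rfl, ← h, mul_sum, sum_mul]
  refine sum_congr rfl fun k hk => ?_
  have hk : k ≤ n := Nat.lt_succ_iff.1 (mem_range.1 hk)
  rw [← Nat.choose_mul_factorial_mul_factorial hk]
  calc _ = n.choose k * ((2 ^ k * (2 * k - 1).doubleFactorial) *
        (2 ^ (n - k) * (2 * (n - k) - 1).doubleFactorial)) := by
        nth_rewrite 1 [← Nat.add_sub_cancel' hk]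
        rw [pow_add]; ring
    _ = _ := by rw [two_pow_mul_doubleFactorial, two_pow_mul_doubleFactorial]; ring

open Finset in
/-- A sequence starting with `1` is determined by its binomial convolution square. -/
theorem eq_of_sum_choose_mul_eq {f g : ℕ → ℕ} (hf : f 0 = 1) (hg : g 0 = 1)
    (h : ∀ n, ∑ k ∈ range (n + 1), n.choose k * (f k * f (n - k)) =
      ∑ k ∈ range (n + 1), n.choose k * (g k * g (n - k))) (n : ℕ) : f n = g n := by
  induction n using Nat.strong_induction_on with
  | _ n ih =>
    cases n with
    | zero => rw [hf, hg]
    | succ n =>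
      have h := h (n + 1)
      rw [sum_range_succ, sum_range_succ', sum_range_succ, sum_range_succ'] at h
      have hmid : ∑ k ∈ range n, (n + 1).choose (k + 1) * (f (k + 1) * f (n + 1 - (k + 1))) =
          ∑ k ∈ range n, (n + 1).choose (k + 1) * (g (k + 1) * g (n + 1 - (k + 1))) := by
        refine sum_congr rfl fun k hk => ?_
        have := mem_range.1 hk
        rw [ih (k + 1) (by omega), ih (n + 1 - (k + 1)) (by omega)]
      rw [hmid] at h
      simp only [Nat.choose_zero_right, Nat.choose_self, Nat.sub_self, Nat.sub_zero, hf, hg] at h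
      omega

/-- Continuations `l` of an integer walk from `x`, with steps of absolute value less than `N`,
visiting every residue modulo `N` in `S` exactly once, and no other residue. -/
def walks (N x : ℤ) (S : Finset ℤ) : Set (List ℤ) :=
  {l | (x :: l).IsChain (fun a b => |a - b| < N) ∧ (l.map (· % N) : Multiset ℤ) = S.val}

/-- The walks from `0` all of whose later positions are positive. -/
def posWalks (N : ℤ) (S : Finset ℤ) : Set (List ℤ) :=
  {l | l ∈ walks N 0 S ∧ ∀ z ∈ l, 0 < z}

theorem nil_mem_walks_iff {N x : ℤ} {S : Finset ℤ} : [] ∈ walks N x S ↔ S = ∅ := by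
  simp [walks, eq_comm]

theorem cons_mem_walks_iff {N x y : ℤ} {S : Finset ℤ} {l : List ℤ} :
    y :: l ∈ walks N x S ↔ |x - y| < N ∧ y % N ∈ S ∧ l ∈ walks N y (S.erase (y % N)) := by
  simp only [walks, Set.mem_ofPred_eq, List.isChain_cons_cons, List.map_cons,
    ← Multiset.cons_coe, Finset.erase_val]
  constructor
  · rintro ⟨⟨h1, h2⟩, h3⟩
    refine ⟨h1, ?_, h2, ?_⟩
    · rw [← Finset.mem_val, ← h3]; simp
    · rw [← h3]; simp
  · rintro ⟨h1, h2, h3, h4⟩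
    refine ⟨⟨h1, h3⟩, ?_⟩
    rw [h4]
    exact Multiset.cons_erase h2

/-- The possible first positions of a walk from `x`. -/
noncomputable def nextPositions (N x : ℤ) (S : Finset ℤ) : Finset ℤ :=
  {y ∈ Finset.Ioo (x - N) (x + N) | y % N ∈ S}

theorem card_nextPositions {N x : ℤ} {S : Finset ℤ} (hS : S ⊆ Finset.Ico 0 N) (hx : x % N ∉ S) :
    (nextPositions N x S).card = 2 * S.card := by
  have hmaps : Set.MapsTo (· % N) (nextPositions N x S : Set ℤ) (S : Set ℤ) :=
    fun y hy => (Finset.mem_filter.1 hy).2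
  rw [Finset.card_eq_sum_card_fiberwise hmaps, mul_comm]
  refine Finset.sum_const_nat fun s hs => ?_
  have hs' := Finset.mem_Ico.1 (hS hs)
  have hN : 0 < N := by omega
  have hsN : s % N = s := Int.emod_eq_of_lt hs'.1 hs'.2
  have hne : (s - x) % N ≠ 0 := by
    intro h
    rw [← Int.emod_eq_emod_iff_emod_sub_eq_zero, hsN] at h
    exact hx (h ▸ hs)
  have hd0 := Int.emod_nonneg (s - x) hN.ne'
  have hdN := Int.emod_lt_of_pos (s - x) hN
  have hd := Int.emod_add_mul_ediv (s - x) N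
  generalize (s - x) % N = d at *
  generalize (s - x) / N = q at *
  have : {y ∈ nextPositions N x S | y % N = s} = {x + d, x + d - N} := by
    ext y
    simp only [nextPositions, Finset.mem_filter, Finset.mem_Ioo, Finset.mem_insert,
      Finset.mem_singleton]
    constructor
    · rintro ⟨⟨⟨h1, h2⟩, -⟩, h3⟩
      have hy := Int.emod_add_mul_ediv y N
      rw [h3] at hy
      generalize y / N = k at *
      have e : y = x + d + N * (q + k) := by rw [← hy]; linear_combination -hd
      have hlt : q + k < 1 := by by_contra! hc; nlinarith
      have hgt : -2 < q + k := by by_contra! hc; nlinarith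
      obtain hk | hk : q + k = 0 ∨ q + k = -1 := by omega
      · left; rw [e, hk]; ring
      · right; rw [e, hk]; ring
    · intro h
      have hmod : y ≡ s [ZMOD N] := by
        refine Int.modEq_iff_dvd.2 ?_
        obtain rfl | rfl := h
        · exact ⟨q, by linear_combination -hd⟩
        · exact ⟨q + 1, by linear_combination -hd⟩
      have hmod : y % N = s := (show y % N = s % N from hmod).trans hsN
      refine ⟨⟨?_, hmod ▸ hs⟩, hmod⟩
      omega
  rw [this, Finset.card_pair (by omega)]

theorem card_walks {N x : ℤ} {S : Finset ℤ} (hS : S ⊆ Finset.Ico 0 N) (hx : x % N ∉ S) :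
    Nat.card (walks N x S) = 2 ^ S.card * S.card.factorial := by
  induction hk : S.card generalizing x S with
  | zero =>
    rw [Finset.card_eq_zero] at hk
    subst hk
    have : walks N x ∅ = {[]} := by
      ext l
      cases l with
      | nil => simp [nil_mem_walks_iff]
      | cons y l => simp [cons_mem_walks_iff]
    simp [this]
  | succ k ih =>
    have ih' : ∀ y : nextPositions N x S,
        Nat.card (walks N y (S.erase (y % N))) = 2 ^ k * k.factorial := by
      intro y
      have hy : (y : ℤ) % N ∈ S := (Finset.mem_filter.1 y.2).2
      refine ih ((Finset.erase_subset _ _).trans hS) (Finset.notMem_erase _ _) ?_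
      rw [Finset.card_erase_of_mem hy, hk, Nat.add_sub_cancel]
    have hfin : ∀ y : nextPositions N x S, Finite (walks N y (S.erase (y % N))) := fun y =>
      Nat.finite_of_card_ne_zero (by rw [ih' y]; positivity)
    have hmem : ∀ y, y ∈ nextPositions N x S ↔ |x - y| < N ∧ y % N ∈ S := by
      intro y
      simp only [nextPositions, Finset.mem_filter, Finset.mem_Ioo, abs_lt]
      constructor <;> rintro ⟨h, h'⟩ <;> exact ⟨by omega, h'⟩
    let F : (Σ y : nextPositions N x S, walks N y (S.erase (y % N))) → walks N x S := fun p =>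
      ⟨p.1 :: p.2, cons_mem_walks_iff.2
        ⟨((hmem _).1 p.1.2).1, ((hmem _).1 p.1.2).2, p.2.2⟩⟩
    have hF : Function.Bijective F := by
      constructor
      · rintro ⟨⟨y, hy⟩, ⟨l, hl⟩⟩ ⟨⟨y', hy'⟩, ⟨l', hl'⟩⟩ h
        simp only [F, Subtype.mk.injEq, List.cons.injEq] at h
        obtain ⟨rfl, rfl⟩ := h
        rfl
      · rintro ⟨l, hl⟩
        cases l with
        | nil => simp [nil_mem_walks_iff.1 hl] at hk
        | cons y l =>
          have h := cons_mem_walks_iff.1 hl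
          exact ⟨⟨⟨y, (hmem y).2 ⟨h.1, h.2.1⟩⟩, ⟨l, h.2.2⟩⟩, rfl⟩
    rw [← Nat.card_eq_of_bijective F hF, Nat.card_sigma, Finset.sum_congr rfl fun y _ => ih' y,
      Finset.sum_const, Finset.card_univ, Fintype.card_coe, card_nextPositions hS hx, hk,
      Nat.factorial_succ, smul_eq_mul]
    ring

theorem finite_posWalks {N : ℤ} {S : Finset ℤ} (hS : S ⊆ Finset.Ioo 0 N) :
    Finite (posWalks N S) := by
  have h : Nat.card (walks N 0 S) ≠ 0 := by
    rw [card_walks (hS.trans Finset.Ioo_subset_Ico_self)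
      (fun h => by simpa using Finset.mem_Ioo.1 (hS h))]
    positivity
  have := Nat.finite_of_card_ne_zero h
  exact Set.Finite.subset (Set.toFinite (walks N 0 S)) fun l hl => hl.1

theorem map_sub_emod_Ico {N : ℤ} (hN : 0 < N) (c : ℤ) :
    (Finset.Ico 0 N).val.map (fun r => (r - c) % N) = (Finset.Ico 0 N).val := by
  have hinj : Set.InjOn (fun r => (r - c) % N) (Finset.Ico 0 N : Set ℤ) := by
    intro a ha b hb h
    have ha := Finset.mem_Ico.1 ha
    have hb := Finset.mem_Ico.1 hb
    have h : a - c ≡ b - c [ZMOD N] := h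
    have h := h.add_right c
    rw [sub_add_cancel, sub_add_cancel] at h
    rwa [Int.ModEq, Int.emod_eq_of_lt ha.1 ha.2, Int.emod_eq_of_lt hb.1 hb.2] at h
  rw [← Finset.image_val_of_injOn hinj]
  congr 1
  refine Finset.eq_of_subset_of_card_le ?_ (Finset.card_image_of_injOn hinj).ge
  intro x hx
  obtain ⟨r, -, rfl⟩ := Finset.mem_image.1 hx
  exact Finset.mem_Ico.2 ⟨Int.emod_nonneg _ hN.ne', Int.emod_lt_of_pos _ hN⟩

theorem Ico_val_eq_cons {N : ℤ} (hN : 0 < N) :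
    (Finset.Ico 0 N).val = 0 ::ₘ (Finset.Ioo 0 N).val := by
  rw [← Finset.insert_val_of_notMem (by simp), Finset.Ioo_insert_left hN]

/-- Integer walks with steps of absolute value less than `N` visiting every residue modulo `N`
exactly once. -/
def fullWalks (N : ℤ) : Set (List ℤ) :=
  {w | w.IsChain (fun a b => |a - b| < N) ∧ (w.map (· % N) : Multiset ℤ) = (Finset.Ico 0 N).val}

theorem mem_walks_iff_cons_mem_fullWalks {N : ℤ} (hN : 0 < N) {l : List ℤ} :
    l ∈ walks N 0 (Finset.Ioo 0 N) ↔ 0 :: l ∈ fullWalks N := by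
  simp [walks, fullWalks, Ico_val_eq_cons hN, ← Multiset.cons_coe]

theorem map_sub_mem_fullWalks {N : ℤ} (hN : 0 < N) {w : List ℤ} (hw : w ∈ fullWalks N) (c : ℤ) :
    w.map (· - c) ∈ fullWalks N := by
  refine ⟨?_, ?_⟩
  · rw [List.isChain_map]
    simpa using hw.1
  · rw [← map_sub_emod_Ico hN c, ← hw.2]
    simp [Function.comp_def]

/-- Two walks from `0` joined at their starting point, the first one being reversed. -/
def joinWalks (u v : List ℤ) : List ℤ := u.reverse ++ 0 :: v

theorem joinWalks_mem_fullWalks_iff {N : ℤ} (hN : 0 < N) {u v : List ℤ} :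
    joinWalks u v ∈ fullWalks N ↔
      (0 :: u).IsChain (fun a b => |a - b| < N) ∧ (0 :: v).IsChain (fun a b => |a - b| < N) ∧
      (u.map (· % N) : Multiset ℤ) + (v.map (· % N) : Multiset ℤ) = (Finset.Ioo 0 N).val := by
  have h1 : (u.reverse ++ [0]).IsChain (fun a b => |a - b| < N) ↔
      (0 :: u).IsChain (fun a b => |a - b| < N) := by
    rw [← List.reverse_cons, List.isChain_reverse]
    simp only [abs_sub_comm]
  have h2 : ((joinWalks u v).map (· % N) : Multiset ℤ) =
      0 ::ₘ ((u.map (· % N) : Multiset ℤ) + (v.map (· % N) : Multiset ℤ)) := by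
    rw [joinWalks, List.map_append, ← Multiset.coe_add, List.map_cons, ← Multiset.cons_coe,
      List.map_reverse, Multiset.coe_reverse, Multiset.add_cons, Int.zero_emod]
  simp only [fullWalks, Set.mem_ofPred_eq]
  rw [h2, Ico_val_eq_cons hN, Multiset.cons_inj_right, joinWalks, List.isChain_split, h1, and_assoc]

/-- The positions after the first one of the translate of a walk that starts at `0`. -/
def rebase (w : List ℤ) : List ℤ := (w.map (· - w.headI)).tail

theorem cons_rebase {w : List ℤ} (hw : w ≠ []) : 0 :: rebase w = w.map (· - w.headI) := by
  cases w with
  | nil => exact absurd rfl hw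
  | cons a t => simp [rebase]

theorem eq_of_rebase_eq {w w' : List ℤ} (hw : ∀ z ∈ w, 0 ≤ z) (hw' : ∀ z ∈ w', 0 ≤ z)
    (h0 : 0 ∈ w) (h0' : 0 ∈ w') (h : rebase w = rebase w') : w = w' := by
  have h : w.map (· - w.headI) = w'.map (· - w'.headI) := by
    rw [← cons_rebase (List.ne_nil_of_mem h0), ← cons_rebase (List.ne_nil_of_mem h0'), h]
  generalize w.headI = c at h
  generalize w'.headI = c' at h
  have h1 : 0 - c ∈ w'.map (· - c') := h ▸ List.mem_map_of_mem h0
  have h2 : 0 - c' ∈ w.map (· - c) := h ▸ List.mem_map_of_mem h0'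
  obtain ⟨b, hb, hbc⟩ := List.mem_map.1 h1
  obtain ⟨d, hd, hdc⟩ := List.mem_map.1 h2
  have := hw' b hb
  have := hw d hd
  have hc : c = c' := by omega
  subst hc
  exact List.map_injective_iff.2 (sub_left_injective) h

theorem exists_joinWalks {N : ℤ} {w : List ℤ} (hne : w ≠ []) (hw : w ∈ fullWalks N) :
    ∃ c u v, w.map (· - c) = joinWalks u v ∧ (∀ z ∈ u, 0 < z) ∧ ∀ z ∈ v, 0 < z := by
  obtain ⟨m, hm, hmin⟩ := Finset.exists_min_image w.toFinset id (by simpa using hne)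
  simp only [List.mem_toFinset, id] at hm hmin
  have hnd : w.Nodup := by
    refine List.Nodup.of_map (· % N) ?_
    rw [← Multiset.coe_nodup, hw.2]
    exact Finset.nodup _
  obtain ⟨s, t, rfl⟩ := List.append_of_mem hm
  have hms : m ∉ s ∧ m ∉ t := by
    rw [List.nodup_middle, List.nodup_cons, List.mem_append] at hnd
    tauto
  refine ⟨m, (s.map (· - m)).reverse, t.map (· - m), by simp [joinWalks], ?_, ?_⟩
  · intro z hz
    obtain ⟨y, hy, rfl⟩ := List.mem_map.1 (List.mem_reverse.1 hz)
    have := hmin y (by simp [hy])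
    have : y ≠ m := by rintro rfl; exact hms.1 hy
    omega
  · intro z hz
    obtain ⟨y, hy, rfl⟩ := List.mem_map.1 hz
    have := hmin y (by simp [hy])
    have : y ≠ m := by rintro rfl; exact hms.2 hy
    omega

open Finset in
/-- Cutting a walk at its minimum gives two positive walks. -/
theorem card_walks_eq_sum_posWalks {N : ℤ} (hN : 0 < N) :
    Nat.card (walks N 0 (Ioo 0 N)) =
      ∑ S ∈ (Ioo 0 N).powerset,
        Nat.card (posWalks N S) * Nat.card (posWalks N (Ioo 0 N \ S)) := by
  have hjoin : ∀ S ∈ (Ioo 0 N).powerset, ∀ u ∈ posWalks N S, ∀ v ∈ posWalks N (Ioo 0 N \ S),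
      joinWalks u v ∈ fullWalks N := by
    intro S hS u hu v hv
    refine (joinWalks_mem_fullWalks_iff hN).2 ⟨hu.1.1, hv.1.1, ?_⟩
    rw [hu.1.2, hv.1.2, sdiff_val]
    exact add_tsub_cancel_of_le (val_le_iff.2 (mem_powerset.1 hS))
  have hne : ∀ u v, joinWalks u v ≠ [] := by simp [joinWalks]
  let F : (Σ S : (Ioo 0 N).powerset, posWalks N S × posWalks N (Ioo 0 N \ S)) →
      walks N 0 (Ioo 0 N) := fun p => ⟨rebase (joinWalks p.2.1 p.2.2), by
    rw [mem_walks_iff_cons_mem_fullWalks hN, cons_rebase (hne _ _)]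
    exact map_sub_mem_fullWalks hN (hjoin _ p.1.2 _ p.2.1.2 _ p.2.2.2) _⟩
  have hF : Function.Bijective F := by
    constructor
    · rintro ⟨⟨S, hS⟩, ⟨u, hu⟩, ⟨v, hv⟩⟩ ⟨⟨S', hS'⟩, ⟨u', hu'⟩, ⟨v', hv'⟩⟩ h
      have h : rebase (joinWalks u v) = rebase (joinWalks u' v') := congrArg Subtype.val h
      have hnn : ∀ {S T u v}, u ∈ posWalks N S → v ∈ posWalks N T →
          ∀ z ∈ joinWalks u v, 0 ≤ z := by
        intro S T u v hu hv z hz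
        simp only [joinWalks, List.mem_append, List.mem_reverse, List.mem_cons] at hz
        obtain hz | rfl | hz := hz
        · exact (hu.2 z hz).le
        · rfl
        · exact (hv.2 z hz).le
      have h := eq_of_rebase_eq (hnn hu hv) (hnn hu' hv') (by simp [joinWalks])
        (by simp [joinWalks]) h
      rw [joinWalks, joinWalks, List.append_cons_inj_of_notMem
        (fun h => lt_irrefl _ (hu.2 0 (List.mem_reverse.1 h)))
        (fun h => lt_irrefl _ (hv.2 0 h))] at h
      obtain ⟨h1, -, rfl⟩ := h
      obtain rfl := List.reverse_injective h1
      obtain rfl : S = S' := val_injective (hu.1.2.symm.trans hu'.1.2)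
      rfl
    · rintro ⟨l, hl⟩
      rw [mem_walks_iff_cons_mem_fullWalks hN] at hl
      obtain ⟨c, u, v, h, hu, hv⟩ := exists_joinWalks (List.cons_ne_nil _ _) hl
      have hfull := map_sub_mem_fullWalks hN hl c
      rw [h, joinWalks_mem_fullWalks_iff hN] at hfull
      obtain ⟨h1, h2, h3⟩ := hfull
      have hle : (u.map (· % N) : Multiset ℤ) ≤ (Ioo 0 N).val := by
        rw [← h3]; exact le_self_add
      let S : Finset ℤ := ⟨_, Multiset.nodup_of_le hle (Ioo 0 N).nodup⟩
      refine ⟨⟨⟨S, mem_powerset.2 (val_le_iff.1 hle)⟩, ⟨u, ⟨h1, rfl⟩, hu⟩, ⟨v, ⟨h2, ?_⟩, hv⟩⟩, ?_⟩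
      · change _ = (Ioo 0 N \ S).val
        rw [sdiff_val, ← h3]
        exact (add_tsub_cancel_left _ _).symm
      · refine Subtype.ext ?_
        change rebase (joinWalks u v) = l
        rw [← h, rebase]
        simp [Function.comp_def]
  have hfin : ∀ S : (Ioo 0 N).powerset, Finite (posWalks N S × posWalks N (Ioo 0 N \ S)) := by
    intro S
    have := finite_posWalks (mem_powerset.1 S.2)
    have := finite_posWalks (N := N) (sdiff_subset (s := Ioo 0 N) (t := S))
    infer_instance
  rw [← Nat.card_eq_of_bijective F hF, Nat.card_sigma,
    ← sum_coe_sort (Ioo 0 N).powerset]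
  exact sum_congr rfl fun S _ => Nat.card_prod _ _

theorem psum_zero {n : ℕ} (p : Fin (n - 1) → ℤ) : psum n p 0 = 0 := by
  simp [psum]

theorem psum_succ {n : ℕ} (p : Fin (n - 1) → ℤ) {j : ℕ} (hj : j < n - 1) :
    psum n p (j + 1) = psum n p j + p ⟨j, hj⟩ := by
  have : Finset.univ.filter (fun i : Fin (n - 1) => i.1 < j + 1) =
      insert ⟨j, hj⟩ (Finset.univ.filter (fun i : Fin (n - 1) => i.1 < j)) := by
    ext i
    simp only [Finset.mem_filter, Finset.mem_univ, true_and, Finset.mem_insert, Fin.ext_iff]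
    omega
  rw [psum, this, Finset.sum_insert (by simp), add_comm, psum]

theorem psum_sub_eq {n : ℕ} (h : ℕ → ℤ) {j : ℕ} (hj : j ≤ n - 1) :
    psum n (fun i => h (i + 1) - h i) j = h j - h 0 := by
  induction j with
  | zero => simp [psum_zero]
  | succ j ih => rw [psum_succ _ hj, ih (by omega)]; simp

/-- The condition for a step between two integers with quotients `h`, `h'` and nonzero remainders
`r`, `r'` modulo `N` to have absolute value less than `N`. -/
theorem abs_sub_lt_iff_step {N h h' r r' : ℤ} (hr : 0 < r) (hr' : 0 < r') (hrN : r < N)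
    (hrN' : r' < N) :
    |(N * h + r) - (N * h' + r')| < N ↔
      (h' - h = -1 ∨ h' - h = 0 ∨ h' - h = 1) ∧ (h' - h = -1 → r < r') ∧
        (h' - h = 1 → r' < r) := by
  obtain ⟨d, rfl⟩ : ∃ d, h' = h + d := ⟨h' - h, by ring⟩
  have e : (N * h + r) - (N * (h + d) + r') = r - r' - N * d := by ring
  rw [e, abs_lt, add_sub_cancel_left]
  constructor
  · rintro ⟨h1, h2⟩
    have h3 : d < 2 := by by_contra! hc; nlinarith
    have h4 : -2 < d := by by_contra! hc; nlinarith
    obtain rfl | rfl | rfl : d = -1 ∨ d = 0 ∨ d = 1 := by omega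
    all_goals omega
  · rintro ⟨rfl | rfl | rfl, h2, h3⟩
    all_goals simp at h2 h3
    all_goals constructor <;> omega

/-- Walks with all their quotients and remainders modulo `N` prescribed. -/
theorem ofFn_mem_posWalks_iff {N : ℤ} {S : Finset ℤ} (hS : S ⊆ Finset.Ioo 0 N) {n : ℕ}
    (hn : S.card = n) (p : Fin (n - 1) → ℤ) (σ : Equiv.Perm (Fin n)) :
    List.ofFn (fun i : Fin n => N * psum n p i + S.orderEmbOfFin hn (σ i)) ∈ posWalks N S ↔
      IsPositivePath n p σ := by
  set e := S.orderEmbOfFin hn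
  have hb : ∀ i, 0 < e i ∧ e i < N := fun i =>
    Finset.mem_Ioo.1 (hS (Finset.orderEmbOfFin_mem S hn i))
  have hres : ((List.ofFn (fun i : Fin n => N * psum n p i + e (σ i))).map (· % N) :
      Multiset ℤ) = S.val := by
    have : ((· % N) ∘ fun i : Fin n => N * psum n p i + e (σ i)) = e ∘ σ := by
      funext i
      have := hb (σ i)
      simp [Int.emod_eq_of_lt this.1.le this.2]
    rw [List.map_ofFn, this, ← Fin.univ_val_map, ← Multiset.map_map, ← Finset.image_val_of_injOn
      σ.injective.injOn, Finset.image_univ_equiv, ← Finset.image_val_of_injOn e.injective.injOn]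
    congr 1
    exact Finset.image_orderEmbOfFin_univ S hn
  have hstep : ∀ (i : ℕ) (hi : i + 1 < n),
      |(N * psum n p i + e (σ ⟨i, by omega⟩)) - (N * psum n p (i + 1) + e (σ ⟨i + 1, hi⟩))| < N ↔
      (p ⟨i, by omega⟩ = -1 ∨ p ⟨i, by omega⟩ = 0 ∨ p ⟨i, by omega⟩ = 1) ∧
      (p ⟨i, by omega⟩ = -1 → σ ⟨i, by omega⟩ < σ ⟨i + 1, hi⟩) ∧
      (p ⟨i, by omega⟩ = 1 → σ ⟨i + 1, hi⟩ < σ ⟨i, by omega⟩) := by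
    intro i hi
    rw [abs_sub_lt_iff_step (hb _).1 (hb _).1 (hb _).2 (hb _).2, psum_succ p (by omega : i < n - 1),
      add_sub_cancel_left, e.lt_iff_lt, e.lt_iff_lt]
  have hnn : ∀ i : Fin n, 0 < N * psum n p i + e (σ i) ↔ 0 ≤ psum n p i := by
    intro i
    have := hb (σ i)
    constructor
    · intro h; by_contra! hc; nlinarith
    · intro h; nlinarith
  have hhead : ∀ y ∈ (List.ofFn (fun i : Fin n => N * psum n p i + e (σ i))).head?,
      |0 - y| < N := by
    cases n with
    | zero => simp
    | succ n =>
      have := hb (σ 0)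
      simp [List.ofFn_succ, psum_zero, abs_lt]
      omega
  simp only [posWalks, walks, Set.mem_ofPred_eq, hres, and_true, List.isChain_cons,
    List.isChain_ofFn, IsPositivePath, StepsOK, Compat, List.mem_ofFn, forall_exists_index,
    forall_apply_eq_imp_iff, hnn]
  constructor
  · rintro ⟨⟨-, h1⟩, h2⟩
    refine ⟨fun i => ((hstep i (by omega)).1 (h1 i (by omega))).1,
      fun i => ((hstep i (by omega)).1 (h1 i (by omega))).2, fun j hj => ?_⟩
    rcases Nat.eq_zero_or_pos j with rfl | hj0
    · rw [psum_zero]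
    · exact h2 ⟨j, by omega⟩
  · rintro ⟨h1, h2, h3⟩
    exact ⟨⟨hhead, fun i hi => (hstep i hi).2 ⟨h1 _, h2 ⟨i, by omega⟩⟩⟩, fun i => h3 i (by omega)⟩

theorem card_posWalks {N : ℤ} {S : Finset ℤ} (hS : S ⊆ Finset.Ioo 0 N) :
    Nat.card (posWalks N S) = positiveCount S.card := by
  generalize hn : S.card = n
  let e := S.orderEmbOfFin hn
  have hb : ∀ i, 0 < e i ∧ e i < N := fun i =>
    Finset.mem_Ioo.1 (hS (Finset.orderEmbOfFin_mem S hn i))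
  let F : {ps : (Fin (n - 1) → ℤ) × Equiv.Perm (Fin n) // IsPositivePath n ps.1 ps.2} →
      posWalks N S := fun ps => ⟨_, (ofFn_mem_posWalks_iff hS hn ps.1.1 ps.1.2).2 ps.2⟩
  refine (Nat.card_eq_of_bijective F ⟨?_, ?_⟩).symm
  · rintro ⟨⟨p, σ⟩, hp⟩ ⟨⟨p', σ'⟩, hp'⟩ h
    have h := congrFun (List.ofFn_injective (congrArg Subtype.val h))
    change ∀ i : Fin n, N * psum n p i + e (σ i) = N * psum n p' i + e (σ' i) at h
    have hσ : ∀ i, e (σ i) = e (σ' i) := by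
      intro i
      have := congrArg (· % N) (h i)
      simpa [Int.emod_eq_of_lt (hb _).1.le (hb _).2] using this
    have hps : ∀ i : Fin n, psum n p i = psum n p' i := by
      intro i
      have := h i
      rw [hσ i, add_left_inj] at this
      have hN : N ≠ 0 := by have := hb (σ i); omega
      exact mul_left_cancel₀ hN this
    have h1 : p = p' := by
      funext i
      have h1 := hps ⟨i, by omega⟩
      have h2 := hps ⟨i + 1, by omega⟩
      simp only [psum_succ _ i.2, h1] at h2
      simpa using h2
    have h2 : σ = σ' := Equiv.ext fun i => e.injective (hσ i)
    subst h1 h2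
    rfl
  · rintro ⟨l, hl⟩
    have hres := hl.1.2
    have hlen : l.length = n := by
      have := congrArg Multiset.card hres
      simpa [hn] using this
    subst hlen
    have hmem : ∀ i : Fin l.length, l.get i % N ∈ S := by
      intro i
      rw [← Finset.mem_val, ← hres, Multiset.mem_coe]
      exact List.mem_map_of_mem (l.get_mem i)
    have hs : ∀ i : Fin l.length, ∃ s, e s = l.get i % N := by
      intro i
      have : l.get i % N ∈ Set.range e := by
        rw [Finset.range_orderEmbOfFin]; exact hmem i
      exact this
    choose s hs using hs
    have hnd : (l.map (· % N)).Nodup := by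
      rw [← Multiset.coe_nodup, hres]; exact S.nodup
    have hsinj : Function.Injective s := by
      intro i j hij
      have : l.get i % N = l.get j % N := by rw [← hs, ← hs, hij]
      exact Fin.ext ((hnd.getElem_inj_iff (hi := by simp) (hj := by simp)).1 (by simpa using this))
    let σ : Equiv.Perm (Fin l.length) := Equiv.ofBijective s (Finite.injective_iff_bijective.1 hsinj)
    let h : ℕ → ℤ := fun i => l.getD i 0 / N
    have h0 : h 0 = 0 := by
      cases l with
      | nil => simp [h]
      | cons a t =>
        have h1 := (List.isChain_cons_cons.1 hl.1.1).1
        have h2 := hl.2 a (by simp)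
        simp only [h, List.getD_cons_zero]
        refine Int.ediv_eq_zero_of_lt h2.le ?_
        rw [abs_lt] at h1
        omega
    let p : Fin (l.length - 1) → ℤ := fun i => h (i + 1) - h i
    have hl' : List.ofFn (fun i : Fin l.length => N * psum l.length p i + e (σ i)) = l := by
      refine Eq.trans ?_ l.ofFn_get
      congr 1
      funext i
      rw [psum_sub_eq h (by omega), h0, sub_zero, Equiv.ofBijective_apply, hs]
      simp [h, Int.mul_ediv_add_emod]
    have hpath : IsPositivePath l.length p σ :=
      (ofFn_mem_posWalks_iff hS hn p σ).1 (hl'.symm ▸ hl)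
    exact ⟨⟨(p, σ), hpath⟩, Subtype.ext hl'⟩

open Finset in
theorem sum_choose_mul_positiveCount (n : ℕ) :
    ∑ k ∈ range (n + 1), n.choose k * (positiveCount k * positiveCount (n - k)) =
      2 ^ n * n.factorial := by
  have hN : (0 : ℤ) < n + 1 := by positivity
  have hcard : (Ioo (0 : ℤ) (n + 1)).card = n := by simp
  have h := card_walks_eq_sum_posWalks hN
  rw [card_walks Ioo_subset_Ico_self (by simp), hcard] at h
  rw [h, sum_congr rfl (g := fun S : Finset ℤ => positiveCount S.card * positiveCount (n - S.card)),
    sum_powerset_apply_card (fun k => positiveCount k * positiveCount (n - k)), hcard]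
  · rfl
  · intro S hS
    rw [card_posWalks (mem_powerset.1 hS), card_posWalks sdiff_subset,
      card_sdiff_of_subset (mem_powerset.1 hS), hcard]

/-- The number of well-labelled positive paths of size `n` equals `(2n-1)!!`. -/
theorem positive_count_eq_doubleFactorial (n : ℕ) :
    positiveCount n = Nat.doubleFactorial (2 * n - 1) := by
  refine eq_of_sum_choose_mul_eq (g := fun n => (2 * n - 1).doubleFactorial) ?_ (by simp) ?_ n
  · simpa using sum_choose_mul_positiveCount 0
  · exact fun n =>
      (sum_choose_mul_positiveCount n).trans (sum_choose_mul_doubleFactorial n).symm
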